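/- For any starting point s₀ ∈ H, the Douglas–Rachford sequences satisfy x_n − x_{n+1} → v_D, x̃_n − x̃_{n+1} → v_D, and ν_n − ν_{n+1} → v_P as n → ∞. -/

import Mathlib

open scoped InnerProductSpace Pointwise Classical
open Filter Topology

noncomputable section

variable {H : Type*} [NormedAddCommGroup H] [InnerProductSpace ℝ H]

/-- The effective domain of an extended-real-valued function. -/
def fdom {α : Type*} (f : α → EReal) : Set α := {x | f x ≠ ⊤}

/-- The Fenchel conjugate `f*(u) = sup_x (⟪x, u⟫ - f x)`. -/
def fconj (f : H → EReal) : H → EReal :=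
  fun u => ⨆ x : H, ((⟪x, u⟫_ℝ : ℝ) : EReal) - f x

/-- The recession function `(rec f)(y) = sup_{x ∈ dom f} (f (x + y) - f x)`. -/
def recFn (f : H → EReal) : H → EReal :=
  fun y => ⨆ x ∈ fdom f, (f (x + y) - f x)

/-- A proper function: never `-∞` and not identically `+∞`. -/
def ProperFn {α : Type*} (f : α → EReal) : Prop := (∀ x, f x ≠ ⊥) ∧ ∃ x, f x ≠ ⊤

/-- Convexity of an extended-real-valued function, via convexity of its epigraph. -/
def ConvexFn (f : H → EReal) : Prop :=
  Convex ℝ {p : H × ℝ | f p.1 ≤ (p.2 : EReal)}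

/-- `v` is the element of minimum norm of `S`, i.e. `v = P_S 0`, the metric
projection of `0` onto `S`. -/
def IsMinNormPoint (S : Set H) (v : H) : Prop := v ∈ S ∧ ∀ w ∈ S, ‖v‖ ≤ ‖w‖

/-- `p` is the metric projection of `x` onto `S`, i.e. `p = P_S x`. -/
def IsProjOn (S : Set H) (x p : H) : Prop := p ∈ S ∧ ∀ w ∈ S, dist x p ≤ dist x w

/-- The polar cone `S° = {u | ∀ x ∈ S, ⟪x, u⟫ ≤ 0}`. -/
def polarCone (s : Set H) : Set H := {u | ∀ x ∈ s, ⟪x, u⟫_ℝ ≤ 0}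

/-- The recession cone `rec S = {x | ∀ y ∈ S, x + y ∈ S}`. -/
def recCone (s : Set H) : Set H := {x | ∀ y ∈ s, x + y ∈ s}

/-- `p = prox_f w`: `p` minimizes `y ↦ f y + ½‖y - w‖²`. -/
def IsProxOf (f : H → EReal) (w p : H) : Prop :=
  ∀ y : H, f p + ((1 / 2 * ‖p - w‖ ^ 2 : ℝ) : EReal) ≤ f y + ((1 / 2 * ‖y - w‖ ^ 2 : ℝ) : EReal)

/-- `u` is a subgradient of the proper function `f` at the point `p` of its domain. -/
def IsSubgradAt (f : H → EReal) (p u : H) : Prop :=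
  p ∈ fdom f ∧ ∀ z ∈ fdom f, (f p).toReal + ⟪u, z - p⟫_ℝ ≤ (f z).toReal

theorem ProperFn.coe_toReal {α : Type*} {f : α → EReal} (hf : ProperFn f) {x : α} (hx : x ∈ fdom f) :
    ((f x).toReal : EReal) = f x :=
  EReal.coe_toReal hx (hf.1 x)

theorem ConvexFn.combo_mem_fdom_and_toReal_le {f : H → EReal} (hf : ProperFn f) (hc : ConvexFn f)
    {x y : H} (hx : x ∈ fdom f) (hy : y ∈ fdom f) {a b : ℝ} (ha : 0 ≤ a) (hb : 0 ≤ b)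
    (hab : a + b = 1) :
    a • x + b • y ∈ fdom f ∧
      (f (a • x + b • y)).toReal ≤ a * (f x).toReal + b * (f y).toReal := by
  have h1 : (x, (f x).toReal) ∈ {p : H × ℝ | f p.1 ≤ (p.2 : EReal)} :=
    (hf.coe_toReal hx).ge
  have h2 : (y, (f y).toReal) ∈ {p : H × ℝ | f p.1 ≤ (p.2 : EReal)} :=
    (hf.coe_toReal hy).ge
  have h3 : f (a • x + b • y) ≤ ((a * (f x).toReal + b * (f y).toReal : ℝ) : EReal) :=
    hc h1 h2 ha hb hab
  have h4 : a • x + b • y ∈ fdom f := ne_top_of_le_ne_top (EReal.coe_ne_top _) h3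
  refine ⟨h4, ?_⟩
  rw [← hf.coe_toReal h4] at h3
  exact_mod_cast h3

theorem ConvexFn.convex_fdom {f : H → EReal} (hf : ProperFn f) (hc : ConvexFn f) :
    Convex ℝ (fdom f) := fun _ hx _ hy _ _ ha hb hab =>
  (hc.combo_mem_fdom_and_toReal_le hf hx hy ha hb hab).1

theorem mem_fdom_fconj_iff {f : H → EReal} (hf : ProperFn f) {y : H} :
    y ∈ fdom (fconj f) ↔ ∃ M : ℝ, ∀ z ∈ fdom f, ⟪z, y⟫_ℝ - (f z).toReal ≤ M := by
  constructor
  · intro hy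
    refine ⟨(fconj f y).toReal, fun z hz => ?_⟩
    have h1 : ((⟪z, y⟫_ℝ : ℝ) : EReal) - f z ≤ fconj f y :=
      le_iSup (fun x : H => ((⟪x, y⟫_ℝ : ℝ) : EReal) - f x) z
    rw [← hf.coe_toReal hz, ← EReal.coe_sub] at h1
    have h2 : fconj f y ≠ ⊥ := ne_bot_of_le_ne_bot (EReal.coe_ne_bot _) h1
    rw [← EReal.coe_toReal hy h2] at h1
    exact_mod_cast h1
  · rintro ⟨M, hM⟩
    refine ne_top_of_le_ne_top (EReal.coe_ne_top M) (iSup_le fun z => ?_)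
    by_cases hz : f z = ⊤
    · simp [hz]
    · rw [← hf.coe_toReal hz, ← EReal.coe_sub]
      exact_mod_cast hM z hz

theorem convex_fdom_fconj {f : H → EReal} (hf : ProperFn f) : Convex ℝ (fdom (fconj f)) := by
  intro y hy y' hy' a b ha hb hab
  rw [mem_fdom_fconj_iff hf] at *
  obtain ⟨M, hM⟩ := hy
  obtain ⟨M', hM'⟩ := hy'
  refine ⟨a * M + b * M', fun z hz => ?_⟩
  rw [inner_add_right, inner_smul_right, inner_smul_right]
  have h1 := mul_le_mul_of_nonneg_left (hM z hz) ha
  have h2 := mul_le_mul_of_nonneg_left (hM' z hz) hb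
  obtain rfl : b = 1 - a := by linarith
  linarith

theorem add_mem_fdom_fconj {f : H → EReal} (hf : ProperFn f) {y n : H} {c : ℝ}
    (hy : y ∈ fdom (fconj f)) (hn : ∀ z ∈ fdom f, ⟪z, n⟫_ℝ ≤ c) :
    y + n ∈ fdom (fconj f) := by
  rw [mem_fdom_fconj_iff hf] at *
  obtain ⟨M, hM⟩ := hy
  refine ⟨M + c, fun z hz => ?_⟩
  rw [inner_add_right]
  linarith [hM z hz, hn z hz]

theorem IsProxOf.isSubgradAt {f : H → EReal} (hf : ProperFn f) (hc : ConvexFn f) {w p : H}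
    (h : IsProxOf f w p) : IsSubgradAt f p (w - p) := by
  have hp : p ∈ fdom f := by
    obtain ⟨y, hy⟩ := hf.2
    intro htop
    have h1 := h y
    rw [htop, EReal.top_add_coe, ← hf.coe_toReal hy, ← EReal.coe_add] at h1
    exact EReal.coe_ne_top _ (top_le_iff.mp h1)
  refine ⟨hp, fun z hz => ?_⟩
  have key : ∀ t : ℝ, 0 < t → t ≤ 1 →
      (f p).toReal - (f z).toReal + ⟪w - p, z - p⟫_ℝ ≤ t * (1 / 2 * ‖z - p‖ ^ 2) := by
    intro t ht ht1
    obtain ⟨h1, h2⟩ := hc.combo_mem_fdom_and_toReal_le hf hp hz (sub_nonneg.mpr ht1) ht.le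
      (sub_add_cancel 1 t)
    have h3 := h ((1 - t) • p + t • z)
    rw [← hf.coe_toReal hp, ← hf.coe_toReal h1, ← EReal.coe_add, ← EReal.coe_add,
      EReal.coe_le_coe_iff] at h3
    have h4 : (1 - t) • p + t • z - w = t • (z - p) - (w - p) := by module
    rw [h4, norm_sub_sq_real (t • (z - p)), real_inner_smul_left, norm_smul, mul_pow,
      Real.norm_eq_abs, sq_abs, norm_sub_rev p w, real_inner_comm] at h3
    refine le_of_mul_le_mul_left ?_ ht
    nlinarith
  have h5 : Tendsto (fun t : ℝ => t * (1 / 2 * ‖z - p‖ ^ 2)) (𝓝[>] 0) (𝓝 0) := by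
    have : Tendsto (fun t : ℝ => t * (1 / 2 * ‖z - p‖ ^ 2)) (𝓝 0)
        (𝓝 (0 * (1 / 2 * ‖z - p‖ ^ 2))) := (continuous_id.mul continuous_const).tendsto 0
    rw [zero_mul] at this
    exact this.mono_left nhdsWithin_le_nhds
  have h6 := ge_of_tendsto h5
    (b := (f p).toReal - (f z).toReal + ⟪w - p, z - p⟫_ℝ) (by
      filter_upwards [Ioc_mem_nhdsGT (zero_lt_one' ℝ)] with t ht using key t ht.1 ht.2)
  linarith

theorem IsSubgradAt.mem_fdom_fconj {f : H → EReal} (hf : ProperFn f) {p u : H}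
    (h : IsSubgradAt f p u) : u ∈ fdom (fconj f) := by
  rw [mem_fdom_fconj_iff hf]
  refine ⟨⟪p, u⟫_ℝ - (f p).toReal, fun z hz => ?_⟩
  have h1 := h.2 z hz
  rw [inner_sub_right, real_inner_comm, real_inner_comm p u] at h1
  linarith

theorem IsSubgradAt.monotone {f : H → EReal} {p u p' u' : H}
    (h : IsSubgradAt f p u) (h' : IsSubgradAt f p' u') : 0 ≤ ⟪p - p', u - u'⟫_ℝ := by
  have h1 := h.2 p' h'.1
  have h2 := h'.2 p h.1
  rw [real_inner_comm] at h1 h2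
  simp only [inner_sub_left, inner_sub_right] at *
  linarith

/-- The Brezis–Haraux property of subdifferentials. -/
theorem exists_forall_isSubgradAt_neg_le_inner {f : H → EReal} (hf : ProperFn f) {z y : H}
    (hz : z ∈ fdom f) (hy : y ∈ fdom (fconj f)) :
    ∃ C : ℝ, ∀ p u, IsSubgradAt f p u → -C ≤ ⟪p - z, u - y⟫_ℝ := by
  obtain ⟨M, hM⟩ := (mem_fdom_fconj_iff hf).mp hy
  refine ⟨(f z).toReal + M - ⟪z, y⟫_ℝ, fun p u h => ?_⟩
  have h1 := h.2 z hz
  have h2 := hM p h.1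
  rw [real_inner_comm] at h1
  simp only [inner_sub_left, inner_sub_right] at *
  linarith

theorem IsMinNormPoint.sq_norm_le_inner {S : Set H} (hS : Convex ℝ S) {v : H}
    (hv : IsMinNormPoint S v) {w : H} (hw : w ∈ S) : ‖v‖ ^ 2 ≤ ⟪w, v⟫_ℝ := by
  have h1 : ‖(0 : H) - v‖ = ⨅ w : S, ‖(0 : H) - w‖ := by
    have : Nonempty S := ⟨⟨v, hv.1⟩⟩
    refine le_antisymm (le_ciInf fun w => by simpa using hv.2 w w.2) ?_
    exact ciInf_le ⟨0, by rintro _ ⟨w, rfl⟩; exact norm_nonneg _⟩ (⟨v, hv.1⟩ : S)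
  have h2 := (norm_eq_iInf_iff_real_inner_le_zero hS hv.1).mp h1 w hw
  rw [zero_sub, inner_neg_left, inner_sub_right, real_inner_self_eq_norm_sq,
    real_inner_comm] at h2
  linarith

section Domains

variable {f g : H → EReal}

theorem add_smul_mem_fdom_fconj_add (hf : ProperFn f) (hg : ProperFn g) {n : H} {c : ℝ}
    (hn : ∀ p ∈ fdom f - fdom g, ⟪p, n⟫_ℝ ≤ c) {r : H}
    (hr : r ∈ fdom (fconj f) + fdom (fconj g)) (t : ℝ) :
    r + t • n ∈ fdom (fconj f) + fdom (fconj g) := by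
  obtain ⟨y, hy, y', hy', rfl⟩ := hr
  obtain ⟨x₀, hx₀⟩ := hf.2
  obtain ⟨z₀, hz₀⟩ := hg.2
  rcases le_total 0 t with ht | ht
  · refine ⟨y + t • n, add_mem_fdom_fconj hf (c := t * (c + ⟪z₀, n⟫_ℝ)) hy fun z hz => ?_,
      y', hy', by simp only; abel⟩
    have h1 := hn (z - z₀) (Set.sub_mem_sub hz hz₀)
    rw [inner_sub_left] at h1
    rw [inner_smul_right]
    exact mul_le_mul_of_nonneg_left (by linarith) ht
  · refine ⟨y, hy, y' + t • n, add_mem_fdom_fconj hg (c := (-t) * (c - ⟪x₀, n⟫_ℝ)) hy'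
      fun z hz => ?_, by simp only; abel⟩
    have h1 := hn (x₀ - z) (Set.sub_mem_sub hx₀ hz)
    rw [inner_sub_left] at h1
    rw [inner_smul_right]
    have := mul_le_mul_of_nonneg_left (show -⟪z, n⟫_ℝ ≤ c - ⟪x₀, n⟫_ℝ by linarith)
      (neg_nonneg.mpr ht)
    linarith

theorem add_smul_mem_closure_fdom_fconj_add (hf : ProperFn f) (hg : ProperFn g) {n : H} {c : ℝ}
    (hn : ∀ p ∈ fdom f - fdom g, ⟪p, n⟫_ℝ ≤ c) {r : H}
    (hr : r ∈ closure (fdom (fconj f) + fdom (fconj g))) (t : ℝ) :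
    r + t • n ∈ closure (fdom (fconj f) + fdom (fconj g)) :=
  map_mem_closure (f := fun r => r + t • n) (by fun_prop) hr
    fun _ h => add_smul_mem_fdom_fconj_add hf hg hn h t

theorem inner_eq_zero_of_bddAbove (hf : ProperFn f) (hg : ProperFn g) {n : H} {c : ℝ}
    (hn : ∀ p ∈ fdom f - fdom g, ⟪p, n⟫_ℝ ≤ c) {vD : H}
    (hvD : IsMinNormPoint (closure (fdom (fconj f) + fdom (fconj g))) vD) :
    ⟪n, vD⟫_ℝ = 0 := by
  have hconv : Convex ℝ (closure (fdom (fconj f) + fdom (fconj g))) :=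
    ((convex_fdom_fconj hf).add (convex_fdom_fconj hg)).closure
  have h := fun t : ℝ => hvD.sq_norm_le_inner hconv
    (add_smul_mem_closure_fdom_fconj_add hf hg hn hvD.1 t)
  have h1 := h 1
  have h2 := h (-1)
  simp only [inner_add_left, inner_smul_left, real_inner_self_eq_norm_sq, conj_trivial] at h1 h2
  linarith

theorem inner_minNormPoint_eq_zero (hf : ProperFn f) (hfc : ConvexFn f) (hg : ProperFn g)
    (hgc : ConvexFn g) {vP vD : H} (hvP : IsMinNormPoint (closure (fdom f - fdom g)) vP)
    (hvD : IsMinNormPoint (closure (fdom (fconj f) + fdom (fconj g))) vD) :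
    ⟪vP, vD⟫_ℝ = 0 := by
  have h := inner_eq_zero_of_bddAbove hf hg (n := -vP) (c := -‖vP‖ ^ 2) (fun p hp => by
    have := hvP.sq_norm_le_inner ((hfc.convex_fdom hf).sub (hgc.convex_fdom hg)).closure
      (subset_closure hp)
    rw [inner_neg_right]
    linarith) hvD
  simpa using h

theorem add_minNormPoint_mem_closure_fconj (hf : ProperFn f) (hfc : ConvexFn f)
    (hg : ProperFn g) (hgc : ConvexFn g) {vP vD : H}
    (hvP : IsMinNormPoint (closure (fdom f - fdom g)) vP)
    (hvD : IsMinNormPoint (closure (fdom (fconj f) + fdom (fconj g))) vD) :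
    vP + vD ∈ closure (fdom (fconj f) + fdom (fconj g)) := by
  have h := add_smul_mem_closure_fdom_fconj_add hf hg (n := -vP) (c := -‖vP‖ ^ 2) (fun p hp => by
    have := hvP.sq_norm_le_inner ((hfc.convex_fdom hf).sub (hgc.convex_fdom hg)).closure
      (subset_closure hp)
    rw [inner_neg_right]
    linarith) hvD.1 (-1)
  simpa [add_comm] using h

theorem add_minNormPoint_mem_closure_fdom_sub [CompleteSpace H] (hf : ProperFn f)
    (hfc : ConvexFn f) (hg : ProperFn g) (hgc : ConvexFn g) {vP vD : H}
    (hvP : IsMinNormPoint (closure (fdom f - fdom g)) vP)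
    (hvD : IsMinNormPoint (closure (fdom (fconj f) + fdom (fconj g))) vD) :
    vP + vD ∈ closure (fdom f - fdom g) := by
  have hconv : Convex ℝ (closure (fdom f - fdom g)) :=
    ((hfc.convex_fdom hf).sub (hgc.convex_fdom hg)).closure
  obtain ⟨q, hq, hmin⟩ := exists_norm_eq_iInf_of_complete_convex ⟨vP, hvP.1⟩
    isClosed_closure.isComplete hconv (vP + vD)
  have hproj := (norm_eq_iInf_iff_real_inner_le_zero hconv hq).mp hmin
  have horth := inner_eq_zero_of_bddAbove hf hg (n := vP + vD - q)
    (c := ⟪vP + vD - q, q⟫_ℝ) (fun p hp => by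
      have := hproj p (subset_closure hp)
      rw [inner_sub_right] at this
      rw [real_inner_comm]
      linarith) hvD
  have h1 := hproj vP hvP.1
  have h2 : ⟪vP + vD - q, vP + vD - q⟫_ℝ ≤ 0 := by
    rw [show vP + vD - q = (vP - q) + vD by abel] at *
    rw [inner_add_right, horth, add_zero]
    exact h1
  rw [real_inner_self_nonpos, sub_eq_zero] at h2
  rwa [h2]

end Domains

section Resolvents

variable {f g : H → EReal} {P Q : H → H}

theorem norm_sub_le_of_isSubgradAt (hP : ∀ w, IsSubgradAt f (P w) (w - P w)) (w w' : H) :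
    ‖P w - P w'‖ ≤ ‖w - w'‖ ∧ ‖(w - P w) - (w' - P w')‖ ≤ ‖w - w'‖ := by
  have h := (hP w).monotone (hP w')
  have h1 : w - w' = (P w - P w') + ((w - P w) - (w' - P w')) := by abel
  have h2 : ‖w - w'‖ ^ 2 = ‖P w - P w'‖ ^ 2 + 2 * ⟪P w - P w', (w - P w) - (w' - P w')⟫_ℝ
      + ‖(w - P w) - (w' - P w')‖ ^ 2 := by
    rw [← norm_add_sq_real, ← h1]
  constructor <;> refine le_of_sq_le_sq ?_ (norm_nonneg _) <;> nlinarith [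
    sq_nonneg ‖P w - P w'‖, sq_nonneg ‖(w - P w) - (w' - P w')‖]

/-- The displacement `s - T s` of the Douglas–Rachford operator `T`. -/
def drDisplacement (P Q : H → H) (s : H) : H := P s - Q ((2 : ℝ) • P s - s)

theorem sq_norm_sub_eq_drDisplacement (P Q : H → H) (s s' : H) :
    ‖s - s'‖ ^ 2 = ‖(s - drDisplacement P Q s) - (s' - drDisplacement P Q s')‖ ^ 2
      + ‖drDisplacement P Q s - drDisplacement P Q s'‖ ^ 2
      + 2 * ⟪P s - P s', (s - P s) - (s' - P s')⟫_ℝ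
      + 2 * ⟪Q ((2 : ℝ) • P s - s) - Q ((2 : ℝ) • P s' - s'),
          ((2 : ℝ) • P s - s - Q ((2 : ℝ) • P s - s))
            - ((2 : ℝ) • P s' - s' - Q ((2 : ℝ) • P s' - s'))⟫_ℝ := by
  unfold drDisplacement
  generalize Q ((2 : ℝ) • P s - s) = y
  generalize Q ((2 : ℝ) • P s' - s') = y'
  generalize P s = x
  generalize P s' = x'
  obtain ⟨a, rfl⟩ : ∃ a, s = a + s' := ⟨s - s', by abel⟩
  obtain ⟨b, rfl⟩ : ∃ b, x = b + x' := ⟨x - x', by abel⟩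
  obtain ⟨c, rfl⟩ : ∃ c, y = c + y' := ⟨y - y', by abel⟩
  rw [show a + s' - s' = a by abel, show b + x' - x' = b by abel, show c + y' - y' = c by abel,
    show a + s' - (b + x' - (c + y')) - (s' - (x' - y')) = a - b + c by abel,
    show b + x' - (c + y') - (x' - y') = b - c by abel,
    show a + s' - (b + x') - (s' - x') = a - b by abel,
    show (2 : ℝ) • (b + x') - (a + s') - (c + y') - ((2 : ℝ) • x' - s' - y')
      = (2 : ℝ) • b - a - c by module]
  simp only [← real_inner_self_eq_norm_sq, inner_add_left, inner_add_right, inner_sub_left,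
    inner_sub_right, inner_smul_right, real_inner_comm a b, real_inner_comm a c,
    real_inner_comm b c]
  ring

theorem sq_norm_add_sq_norm_le_drDisplacement (P : H → H)
    (hQ : ∀ w, IsSubgradAt g (Q w) (w - Q w)) (s s' : H) :
    ‖(s - drDisplacement P Q s) - (s' - drDisplacement P Q s')‖ ^ 2
      + ‖drDisplacement P Q s - drDisplacement P Q s'‖ ^ 2
      + 2 * ⟪P s - P s', (s - P s) - (s' - P s')⟫_ℝ ≤ ‖s - s'‖ ^ 2 := by
  have := (hQ ((2 : ℝ) • P s - s)).monotone (hQ ((2 : ℝ) • P s' - s'))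
  rw [sq_norm_sub_eq_drDisplacement P Q s s']
  linarith

theorem exists_drDisplacement_add_smul_eq [CompleteSpace H]
    (hP : ∀ w, IsSubgradAt f (P w) (w - P w)) (hQ : ∀ w, IsSubgradAt g (Q w) (w - Q w))
    (v : H) {ε : ℝ} (hε : 0 < ε) : ∃ s, drDisplacement P Q s + ε • s = v := by
  have hpos : 0 < 1 + ε := by linarith
  have hK : (0 : ℝ) ≤ (1 + ε)⁻¹ := by positivity
  have hcontr : ContractingWith ⟨(1 + ε)⁻¹, hK⟩
      (fun s => (1 + ε)⁻¹ • (s - drDisplacement P Q s + v)) := by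
    refine ⟨NNReal.coe_lt_coe.mp (inv_lt_one_of_one_lt₀ (by linarith)),
      LipschitzWith.of_dist_le_mul fun s s' => ?_⟩
    · rw [dist_eq_norm, dist_eq_norm, ← smul_sub, norm_smul, add_sub_add_right_eq_sub,
        Real.norm_of_nonneg hK]
      refine mul_le_mul_of_nonneg_left (le_of_sq_le_sq ?_ (norm_nonneg _)) hK
      have h1 := sq_norm_add_sq_norm_le_drDisplacement P hQ s s'
      have h2 := (hP s).monotone (hP s')
      nlinarith [sq_nonneg ‖drDisplacement P Q s - drDisplacement P Q s'‖]
  have : Nonempty H := ⟨v⟩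
  refine ⟨ContractingWith.fixedPoint _ hcontr, ?_⟩
  have hfix : (1 + ε)⁻¹ • (_ - drDisplacement P Q _ + v) = _ := hcontr.fixedPoint_isFixedPt
  rw [inv_smul_eq_iff₀ hpos.ne', add_smul, one_smul] at hfix
  generalize ContractingWith.fixedPoint _ hcontr = s at *
  rw [← sub_eq_zero] at hfix ⊢
  rw [← neg_eq_zero, ← hfix]
  abel

theorem exists_pos_mul_le {A B η : ℝ} (hA : 0 ≤ A) (hB : 0 ≤ B) (hη : 0 < η) :
    ∃ ε : ℝ, 0 < ε ∧ ε ≤ 1 / 2 ∧ ε * A ≤ η ∧ ε * B ≤ η ^ 2 := by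
  have h1 : 0 < A + 1 := by positivity
  have h2 : 0 < B + 1 := by positivity
  refine ⟨min (1 / 2) (min (η / (A + 1)) (η ^ 2 / (B + 1))), by positivity,
    min_le_left _ _, ?_, ?_⟩
  · calc _ ≤ η / (A + 1) * (A + 1) := mul_le_mul
          ((min_le_right _ _).trans (min_le_left _ _)) (by linarith) hA
          (by positivity)
      _ = η := div_mul_cancel₀ _ h1.ne'
  · calc _ ≤ η ^ 2 / (B + 1) * (B + 1) := mul_le_mul
          ((min_le_right _ _).trans (min_le_right _ _)) (by linarith) hB
          (by positivity)
      _ = η ^ 2 := div_mul_cancel₀ _ h2.ne'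

theorem mul_le_of_mul_sq_le {ε η A B t : ℝ} (hη : 0 < η) (hε : 0 < ε) (ht : 0 ≤ t)
    (hε1 : ε ≤ 1 / 2) (hε2 : ε * A ≤ η) (hε3 : ε * B ≤ η ^ 2)
    (h : ε * t ^ 2 ≤ ε * (A * t) + 2 * η * t + 2 * (ε * (t * η)) + B) : ε * t ≤ 5 * η := by
  have hquad : (ε * t) ^ 2 ≤ 4 * η * (ε * t) + η ^ 2 := by
    have d1 := mul_le_mul_of_nonneg_left h hε.le
    have d2 := mul_le_mul_of_nonneg_right hε2 (by positivity : 0 ≤ ε * t)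
    have d3 := mul_le_mul_of_nonneg_right hε1 (by positivity : 0 ≤ 2 * η * (ε * t))
    nlinarith
  by_contra! hlt
  nlinarith

theorem exists_norm_drDisplacement_sub_le [CompleteSpace H] (hf : ProperFn f) (hg : ProperFn g)
    (hP : ∀ w, IsSubgradAt f (P w) (w - P w)) (hQ : ∀ w, IsSubgradAt g (Q w) (w - Q w)) {v : H}
    (hv : v ∈ closure (fdom f - fdom g)) (hv' : v ∈ closure (fdom (fconj f) + fdom (fconj g)))
    {η : ℝ} (hη : 0 < η) : ∃ s, ‖drDisplacement P Q s - v‖ ≤ 5 * η := by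
  obtain ⟨_, ⟨z, hz, z', hz', rfl⟩, hp⟩ := Metric.mem_closure_iff.mp hv η hη
  obtain ⟨_, ⟨y, hy, y', hy', rfl⟩, hr⟩ := Metric.mem_closure_iff.mp hv' η hη
  obtain ⟨C, hC⟩ := exists_forall_isSubgradAt_neg_le_inner hf hz hy
  obtain ⟨C', hC'⟩ := exists_forall_isSubgradAt_neg_le_inner hg hz' hy'
  simp only [dist_eq_norm] at hp hr
  set K := ‖P 0 - z‖ + ‖P 0 + y‖
  set B := |η * K + η ^ 2 + (C + C')|
  obtain ⟨ε, hε, hε1, hε2, hε3⟩ := exists_pos_mul_le (norm_nonneg (z + y)) (abs_nonneg _) hη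
  obtain ⟨s, hs⟩ := exists_drDisplacement_add_smul_eq hP hQ v hε
  refine ⟨s, ?_⟩
  have hnorm : ‖drDisplacement P Q s - v‖ = ε * ‖s‖ := by
    rw [← hs, sub_add_cancel_left, norm_neg, norm_smul, Real.norm_of_nonneg hε.le]
  have hin := add_le_add (hC _ _ (hP s)) (hC' _ _ (hQ ((2 : ℝ) • P s - s)))
  have hn := norm_sub_le_of_isSubgradAt hP s 0
  rw [sub_zero] at hn
  have hx : ‖P s - z‖ ≤ ‖s‖ + ‖P 0 - z‖ := by
    rw [show P s - z = (P s - P 0) + (P 0 - z) by abel]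
    exact (norm_add_le _ _).trans (by linarith [hn.1])
  have hν : ‖s - P s - y‖ ≤ ‖s‖ + ‖P 0 + y‖ := by
    rw [show s - P s - y = (s - P s - (0 - P 0)) - (P 0 + y) by abel]
    exact (norm_sub_le _ _).trans (by linarith [hn.2])
  set e := v - (z - z') with he
  set e' := v - (y + y') with he'
  have hxt : Q ((2 : ℝ) • P s - s) - z' = (P s - z) - (e - ε • s) := by
    rw [he, ← hs]; unfold drDisplacement; abel
  have hut : (2 : ℝ) • P s - s - Q ((2 : ℝ) • P s - s) - y' = (e' - ε • s) - (s - P s - y) := by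
    rw [he', ← hs]; unfold drDisplacement; module
  have hsum : s = (P s - z) + (s - P s - y) + (z + y) := by abel
  rw [hut, hxt] at hin
  rw [hnorm]
  set X := P s - z
  set N := s - P s - y
  have hexp : ⟪X, N⟫_ℝ + ⟪X - (e - ε • s), (e' - ε • s) - N⟫_ℝ =
      -ε * ⟪X + N, s⟫_ℝ + ⟪X, e'⟫_ℝ + ⟪N, e⟫_ℝ - ⟪e, e'⟫_ℝ + ε * ⟪s, e⟫_ℝ + ε * ⟪s, e'⟫_ℝ
        - (ε * ‖s‖) ^ 2 := by
    rw [mul_pow, ← real_inner_self_eq_norm_sq]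
    simp only [inner_add_left, inner_sub_left, inner_sub_right, inner_smul_left,
      inner_smul_right, conj_trivial, real_inner_comm N e, real_inner_comm e s,
      real_inner_comm N s]
    ring
  rw [hexp, show X + N = s - (z + y) from eq_sub_of_add_eq hsum.symm, inner_sub_left,
    real_inner_self_eq_norm_sq] at hin
  have b1 : ⟪z + y, s⟫_ℝ ≤ ‖z + y‖ * ‖s‖ := real_inner_le_norm _ _
  have b2 : ⟪X, e'⟫_ℝ ≤ (‖s‖ + ‖P 0 - z‖) * η := (real_inner_le_norm _ _).trans
    (mul_le_mul hx hr.le (norm_nonneg _) (by positivity))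
  have b3 : ⟪N, e⟫_ℝ ≤ (‖s‖ + ‖P 0 + y‖) * η := (real_inner_le_norm _ _).trans
    (mul_le_mul hν hp.le (norm_nonneg _) (by positivity))
  have b4 : -⟪e, e'⟫_ℝ ≤ η * η := by
    rw [← inner_neg_left]
    exact (real_inner_le_norm _ _).trans (by
      rw [norm_neg]; exact mul_le_mul hp.le hr.le (norm_nonneg _) hη.le)
  have b5 : ⟪s, e⟫_ℝ ≤ ‖s‖ * η := (real_inner_le_norm _ _).trans
    (mul_le_mul_of_nonneg_left hp.le (norm_nonneg _))
  have b6 : ⟪s, e'⟫_ℝ ≤ ‖s‖ * η := (real_inner_le_norm _ _).trans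
    (mul_le_mul_of_nonneg_left hr.le (norm_nonneg _))
  have c1 := mul_le_mul_of_nonneg_left b1 hε.le
  have c5 := mul_le_mul_of_nonneg_left b5 hε.le
  have c6 := mul_le_mul_of_nonneg_left b6 hε.le
  have hB' : η * K + η ^ 2 + (C + C') ≤ B := le_abs_self _
  have hmain : ε * ‖s‖ ^ 2 ≤ ε * (‖z + y‖ * ‖s‖) + 2 * η * ‖s‖ + 2 * (ε * (‖s‖ * η)) + B := by
    nlinarith [sq_nonneg (ε * ‖s‖)]
  exact mul_le_of_mul_sq_le hη hε (norm_nonneg s) hε1 hε2 hε3 hmain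

theorem tendsto_of_sq_norm_add_le {E : Type*} [NormedAddCommGroup E] {c : ℕ → ℝ} {d : ℕ → E}
    (hc : ∀ n, 0 ≤ c n) (h : ∀ n, c (n + 1) + ‖d n‖ ^ 2 ≤ c n) :
    Tendsto d atTop (𝓝 0) := by
  have hanti : Antitone c := antitone_nat_of_succ_le fun n => by
    linarith [h n, sq_nonneg ‖d n‖]
  have hlim := tendsto_atTop_ciInf hanti ⟨0, by rintro _ ⟨n, rfl⟩; exact hc n⟩
  have hdiff := hlim.sub (hlim.comp (tendsto_add_atTop_nat 1))
  rw [sub_self] at hdiff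
  have hsq : Tendsto (fun n => ‖d n‖ ^ 2) atTop (𝓝 0) :=
    squeeze_zero (fun n => sq_nonneg _) (fun n => by
      simp only [Function.comp]; linarith [h n]) hdiff
  have := hsq.sqrt
  simp only [Real.sqrt_sq (norm_nonneg _), Real.sqrt_zero] at this
  exact tendsto_zero_iff_norm_tendsto_zero.mpr this

theorem tendsto_drDisplacement (hP : ∀ w, IsSubgradAt f (P w) (w - P w))
    (hQ : ∀ w, IsSubgradAt g (Q w) (w - Q w)) {v : H}
    (hclose : ∀ η > 0, ∃ s, ‖drDisplacement P Q s - v‖ ≤ η)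
    (hmin : ∀ s, ‖v‖ ^ 2 ≤ ⟪drDisplacement P Q s, v⟫_ℝ) {s : ℕ → H}
    (hs : ∀ n, s (n + 1) = s n - drDisplacement P Q (s n)) :
    Tendsto (fun n => drDisplacement P Q (s n)) atTop (𝓝 v) := by
  have hfirm : ∀ a b : H, ‖(a - drDisplacement P Q a) - (b - drDisplacement P Q b)‖ ^ 2
      + ‖drDisplacement P Q a - drDisplacement P Q b‖ ^ 2 ≤ ‖a - b‖ ^ 2 := fun a b => by
    linarith [sq_norm_add_sq_norm_le_drDisplacement P hQ a b, (hP a).monotone (hP b)]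
  have hbound : ∀ η > 0, ∀ᶠ n in atTop, ‖drDisplacement P Q (s n)‖ < ‖v‖ + η := by
    intro η hη
    obtain ⟨b, hb⟩ := hclose (η / 2) (by positivity)
    let r : ℕ → H := fun n => (fun a => a - drDisplacement P Q a)^[n] b
    have hr : ∀ n, r (n + 1) = r n - drDisplacement P Q (r n) := fun n =>
      Function.iterate_succ_apply' _ _ _
    have hrle : ∀ n, ‖drDisplacement P Q (r n)‖ ≤ ‖v‖ + η / 2 := by
      intro n
      induction n with
      | zero =>
        change ‖drDisplacement P Q b‖ ≤ _
        linarith [norm_le_norm_add_norm_sub' (drDisplacement P Q b) v]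
      | succ n ih =>
        refine le_trans (le_of_sq_le_sq ?_ (norm_nonneg _)) ih
        have h1 := hfirm (r n) (r (n + 1))
        rw [← hr, ← hr, show r n - r (n + 1) = drDisplacement P Q (r n) by rw [hr]; abel,
          show r (n + 1) - r (n + 1 + 1) = drDisplacement P Q (r (n + 1)) by
            rw [hr (n + 1)]; abel] at h1
        nlinarith [sq_nonneg ‖drDisplacement P Q (r n) - drDisplacement P Q (r (n + 1))‖]
    have hdiff : Tendsto (fun n => drDisplacement P Q (s n) - drDisplacement P Q (r n)) atTop
        (𝓝 0) := by
      refine tendsto_of_sq_norm_add_le (c := fun n => ‖s n - r n‖ ^ 2) (fun n => sq_nonneg _)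
        fun n => ?_
      simp only [hs n, hr n]
      exact hfirm _ _
    filter_upwards [(tendsto_zero_iff_norm_tendsto_zero.mp hdiff).eventually_lt_const
      (show 0 < η / 2 by positivity)] with n hn
    linarith [hrle n, norm_le_norm_add_norm_sub' (drDisplacement P Q (s n))
      (drDisplacement P Q (r n))]
  have hge : ∀ n, ‖v‖ ≤ ‖drDisplacement P Q (s n)‖ := by
    intro n
    by_contra! hlt
    have h1 := hmin (s n)
    have h2 := real_inner_le_norm (drDisplacement P Q (s n)) v
    nlinarith [norm_nonneg v, norm_nonneg (drDisplacement P Q (s n))]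
  have hnorm : Tendsto (fun n => ‖drDisplacement P Q (s n)‖) atTop (𝓝 ‖v‖) := by
    refine tendsto_order.mpr ⟨fun a ha => Eventually.of_forall fun n => ha.trans_le (hge n),
      fun a ha => ?_⟩
    filter_upwards [hbound (a - ‖v‖) (by linarith)] with n hn
    linarith
  have hsq : Tendsto (fun n => ‖drDisplacement P Q (s n) - v‖ ^ 2) atTop (𝓝 0) := by
    have h0 := (hnorm.pow 2).sub_const (‖v‖ ^ 2)
    rw [sub_self] at h0
    refine squeeze_zero (fun n => sq_nonneg _) (fun n => ?_) h0
    rw [norm_sub_sq_real]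
    linarith [hmin (s n)]
  have := hsq.sqrt
  simp only [Real.sqrt_sq (norm_nonneg _), Real.sqrt_zero] at this
  exact tendsto_iff_norm_sub_tendsto_zero.mpr this

end Resolvents

/-- If the limit `w` of `x n - y n` minimizes `⟪·, v⟫` among all differences `x m - y n`, then the
increments of `x` are asymptotically orthogonal to `v`. -/
theorem tendsto_inner_sub_succ_zero {x y : ℕ → H} {v w : H}
    (hle : ∀ m n, ⟪w, v⟫_ℝ ≤ ⟪x m - y n, v⟫_ℝ)
    (hlim : Tendsto (fun n => x n - y n) atTop (𝓝 w)) :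
    Tendsto (fun n => ⟪x n - x (n + 1), v⟫_ℝ) atTop (𝓝 0) := by
  have h0 : Tendsto (fun n => ⟪x n - y n, v⟫_ℝ - ⟪w, v⟫_ℝ) atTop (𝓝 0) := by
    simpa using (hlim.inner (tendsto_const_nhds (x := v))).sub_const ⟪w, v⟫_ℝ
  have h1 := (h0.comp (tendsto_add_atTop_nat 1)).neg
  rw [neg_zero] at h1
  refine tendsto_of_tendsto_of_tendsto_of_le_of_le h1 h0 (fun n => ?_) fun n => ?_
  · have := hle n (n + 1)
    simp only [Function.comp, inner_sub_left] at *
    linarith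
  · have := hle (n + 1) n
    simp only [inner_sub_left] at *
    linarith

theorem douglasRachford_successive_differences_tendsto {H : Type*} [NormedAddCommGroup H] [InnerProductSpace ℝ H]
    [FiniteDimensional ℝ H]
    (f g : H → EReal)
    (hf_prop : ProperFn f) (hf_lsc : LowerSemicontinuous f) (hf_cvx : ConvexFn f)
    (hg_prop : ProperFn g) (hg_lsc : LowerSemicontinuous g) (hg_cvx : ConvexFn g)
    (vP : H) (hvP : IsMinNormPoint (closure (fdom f - fdom g)) vP)
    (vD : H) (hvD : IsMinNormPoint (closure (fdom (fconj f) + fdom (fconj g))) vD)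
    (s₀ : H) (proxf proxg : H → H)
    (hproxf : ∀ w : H, IsProxOf f w (proxf w))
    (hproxg : ∀ w : H, IsProxOf g w (proxg w))
    (s x ν xt : ℕ → H)
    (hs₀ : s 0 = s₀)
    (hx : ∀ n : ℕ, x n = proxf (s n))
    (hν : ∀ n : ℕ, ν n = s n - x n)
    (hxt : ∀ n : ℕ, xt n = proxg ((2 : ℝ) • x n - s n))
    (hs : ∀ n : ℕ, s (n + 1) = s n + xt n - x n)
    : Tendsto (fun n : ℕ => x n - x (n + 1)) atTop (𝓝 vD) ∧
      Tendsto (fun n : ℕ => xt n - xt (n + 1)) atTop (𝓝 vD) ∧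
      Tendsto (fun n : ℕ => ν n - ν (n + 1)) atTop (𝓝 vP) := by
  have hcD := ((hf_cvx.convex_fdom hf_prop).sub (hg_cvx.convex_fdom hg_prop)).closure
  have hcR := ((convex_fdom_fconj hf_prop).add (convex_fdom_fconj hg_prop)).closure
  have hP : ∀ w, IsSubgradAt f (proxf w) (w - proxf w) := fun w =>
    (hproxf w).isSubgradAt hf_prop hf_cvx
  have hQ : ∀ w, IsSubgradAt g (proxg w) (w - proxg w) := fun w =>
    (hproxg w).isSubgradAt hg_prop hg_cvx
  have hsub_f : ∀ n, IsSubgradAt f (x n) (ν n) := fun n => by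
    rw [hν, hx]; exact hP _
  have hsub_g : ∀ n, IsSubgradAt g (xt n) ((2 : ℝ) • x n - s n - xt n) := fun n => by
    rw [hxt]; exact hQ _
  have hprimal : ∀ p ∈ fdom f - fdom g, ‖vP‖ ^ 2 ≤ ⟪p, vP⟫_ℝ := fun p hp =>
    hvP.sq_norm_le_inner hcD (subset_closure hp)
  have hdual : ∀ p ∈ fdom (fconj f) + fdom (fconj g), ‖vD‖ ^ 2 ≤ ⟪p, vD⟫_ℝ := fun p hp =>
    hvD.sq_norm_le_inner hcR (subset_closure hp)
  have horth : ⟪vP, vD⟫_ℝ = 0 :=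
    inner_minNormPoint_eq_zero hf_prop hf_cvx hg_prop hg_cvx hvP hvD
  have hsq : ‖vP + vD‖ ^ 2 = ‖vP‖ ^ 2 + ‖vD‖ ^ 2 := by
    rw [norm_add_sq_real, horth]; ring
  have hd : ∀ n, drDisplacement proxf proxg (s n) = x n - xt n := fun n => by
    rw [drDisplacement, hxt, hx]
  have hs' : ∀ n, s (n + 1) = s n - drDisplacement proxf proxg (s n) := fun n => by
    rw [hs, hd]; abel
  have hlim : Tendsto (fun n => x n - xt n) atTop (𝓝 (vP + vD)) := by
    simp only [← hd]
    refine tendsto_drDisplacement hP hQ (fun η hη => ?_) (fun a => ?_) hs'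
    · obtain ⟨a, ha⟩ := exists_norm_drDisplacement_sub_le hf_prop hg_prop hP hQ
        (add_minNormPoint_mem_closure_fdom_sub hf_prop hf_cvx hg_prop hg_cvx hvP hvD)
        (add_minNormPoint_mem_closure_fconj hf_prop hf_cvx hg_prop hg_cvx hvP hvD)
        (show 0 < η / 5 by positivity)
      exact ⟨a, by linarith⟩
    · rw [hsq, inner_add_right]
      refine add_le_add (hprimal _ (Set.sub_mem_sub (hP a).1 (hQ _).1)) (hdual _ ?_)
      rw [show drDisplacement proxf proxg a = (a - proxf a) + ((2 : ℝ) • proxf a - a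
        - proxg ((2 : ℝ) • proxf a - a)) by unfold drDisplacement; module]
      exact Set.add_mem_add ((hP a).mem_fdom_fconj hf_prop) ((hQ _).mem_fdom_fconj hg_prop)
  have hdecomp : ∀ n, x n - xt n = (x n - x (n + 1)) + (ν n - ν (n + 1)) := fun n => by
    rw [hν, hν, hs n]; abel
  have hxv : Tendsto (fun n => ⟪x n - x (n + 1), vP⟫_ℝ) atTop (𝓝 0) := by
    refine tendsto_inner_sub_succ_zero (fun m n => ?_) hlim
    rw [inner_add_left, real_inner_self_eq_norm_sq, real_inner_comm, horth, add_zero]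
    exact hprimal _ (Set.sub_mem_sub (hsub_f m).1 (hsub_g n).1)
  have hνv : Tendsto (fun n => ⟪ν n - ν (n + 1), vD⟫_ℝ) atTop (𝓝 0) := by
    refine tendsto_inner_sub_succ_zero (y := fun n => -((2 : ℝ) • x n - s n - xt n))
      (w := vP + vD) (fun m n => ?_) ?_
    · rw [inner_add_left, real_inner_self_eq_norm_sq, horth, zero_add, sub_neg_eq_add]
      exact hdual _ (Set.add_mem_add ((hsub_f m).mem_fdom_fconj hf_prop)
        ((hsub_g n).mem_fdom_fconj hg_prop))
    · convert hlim using 2 with n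
      rw [hν]; module
  have hmono : ∀ n, 0 ≤ ⟪x n - x (n + 1), ν n - ν (n + 1)⟫_ℝ := fun n =>
    (hsub_f n).monotone (hsub_f (n + 1))
  have herr : Tendsto (fun n => ‖x n - xt n‖ ^ 2
      - 2 * (⟪x n - xt n, vP + vD⟫_ℝ - ⟪x n - x (n + 1), vP⟫_ℝ - ⟪ν n - ν (n + 1), vD⟫_ℝ)
      + (‖vP‖ ^ 2 + ‖vD‖ ^ 2)) atTop (𝓝 0) := by
    have := ((hlim.norm.pow 2).sub ((((hlim.inner (tendsto_const_nhds (x := vP + vD))).sub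
      hxv).sub hνv).const_mul 2)).add_const (‖vP‖ ^ 2 + ‖vD‖ ^ 2)
    convert this using 2
    rw [real_inner_self_eq_norm_sq, hsq]; ring
  have hexp : ∀ n, ‖x n - x (n + 1) - vD‖ ^ 2 + ‖ν n - ν (n + 1) - vP‖ ^ 2 ≤ ‖x n - xt n‖ ^ 2
      - 2 * (⟪x n - xt n, vP + vD⟫_ℝ - ⟪x n - x (n + 1), vP⟫_ℝ - ⟪ν n - ν (n + 1), vD⟫_ℝ)
      + (‖vP‖ ^ 2 + ‖vD‖ ^ 2) := fun n => by
    have h := hmono n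
    rw [hdecomp n, norm_add_sq_real, norm_sub_sq_real, norm_sub_sq_real (ν n - ν (n + 1)),
      inner_add_left, inner_add_right, inner_add_right]
    linarith
  have hx_lim : Tendsto (fun n => x n - x (n + 1)) atTop (𝓝 vD) := by
    refine tendsto_iff_norm_sub_tendsto_zero.mpr ?_
    have := (squeeze_zero (fun n => sq_nonneg ‖x n - x (n + 1) - vD‖) (fun n => by
      linarith [hexp n, sq_nonneg ‖ν n - ν (n + 1) - vP‖]) herr).sqrt
    simpa only [Real.sqrt_sq (norm_nonneg _), Real.sqrt_zero] using this
  refine ⟨hx_lim, ?_, ?_⟩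
  · have := (hx_lim.sub hlim).add (hlim.comp (tendsto_add_atTop_nat 1))
    rw [sub_add_cancel] at this
    refine this.congr fun n => ?_
    simp only [Function.comp]; abel
  · have := hlim.sub hx_lim
    rw [add_sub_cancel_right] at this
    refine this.congr fun n => ?_
    rw [hdecomp n]; abel

end
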